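/- Let $G=(V,E)$ be a finite simple graph with $|V| = n \ge 2$ and $|E| = m \ge 1$, let $\tau \ge 1$ and $\varepsilon_\mathcal{D} \in (0,1/2]$, and let $e_1,\dots,e_r$ be edges sampled independently and uniformly at random from $E$. For each vertex $v$ define $\widehat{\deg}(v) = \frac{m}{r}\,\big|\{j \in [r] : v \in e_j\}\big|$. Then with probability at least $1 - n\exp\big(-\tfrac{r\,\tau\,\varepsilon_\mathcal{D}^2}{10m}\big)$, simultaneously every vertex $v$ with $\deg(v) \le \tau(1-\varepsilon_\mathcal{D})$ satisfies $\widehat{\deg}(v) \le \tau$. -/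

import Mathlib

open MeasureTheory ProbabilityTheory

/-- A set whose outer measure and that of its complement add up to at most the total mass is
null measurable. -/
theorem nullMeasurableSet_of_measure_add_compl_le {Ω : Type*} [MeasurableSpace Ω]
    {μ : Measure Ω} [IsFiniteMeasure μ] {s : Set Ω} (h : μ s + μ sᶜ ≤ μ Set.univ) :
    NullMeasurableSet s μ := by
  have hunion : toMeasurable μ s ∪ toMeasurable μ sᶜ = Set.univ :=
    Set.eq_univ_of_univ_subset <| (Set.union_compl_self s).symm.subset.trans <|
      Set.union_subset_union (subset_toMeasurable μ s) (subset_toMeasurable μ sᶜ)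
  have key := measure_union_add_inter (μ := μ) (toMeasurable μ s)
    (measurableSet_toMeasurable μ sᶜ)
  rw [hunion, measure_toMeasurable, measure_toMeasurable] at key
  have hinter : μ (toMeasurable μ s ∩ toMeasurable μ sᶜ) = 0 := by
    have h1 : μ Set.univ + μ (toMeasurable μ s ∩ toMeasurable μ sᶜ) ≤ μ Set.univ + 0 := by
      rw [key, add_zero]; exact h
    exact nonpos_iff_eq_zero.1 ((ENNReal.add_le_add_iff_left (measure_ne_top μ _)).1 h1)
  have hdiff : μ (toMeasurable μ s \ s) = 0 :=
    measure_mono_null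
      (Set.inter_subset_inter_right (toMeasurable μ s) (subset_toMeasurable μ sᶜ)) hinter
  have hs : s = toMeasurable μ s \ (toMeasurable μ s \ s) := by
    rw [Set.sdiff_sdiff_cancel_left (subset_toMeasurable μ s)]
  rw [hs]
  exact (measurableSet_toMeasurable μ s).nullMeasurableSet.diff (.of_null hdiff)

theorem measure_preimage_le_card_mul {Ω α : Type*} [MeasurableSpace Ω] {μ : Measure Ω}
    {f : Ω → α} {A : Finset α} {c : ENNReal} (hc : ∀ a ∈ A, μ {ω | f ω = a} = c)
    {s : Set Ω} (hs : ∀ ω ∈ s, f ω ∈ A) : μ s ≤ A.card * c := by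
  calc μ s ≤ μ (⋃ a ∈ A, {ω | f ω = a}) :=
        measure_mono fun ω hω => Set.mem_iUnion₂.2 ⟨f ω, hs ω hω, rfl⟩
    _ ≤ ∑ a ∈ A, μ {ω | f ω = a} := measure_biUnion_finset_le _ _
    _ = A.card * c := by rw [Finset.sum_congr rfl hc, Finset.sum_const, nsmul_eq_mul]

/-- Preimages under a uniformly distributed map are null measurable, even if the map is not
assumed to be measurable. -/
theorem nullMeasurableSet_preimage_of_uniform {Ω α : Type*} [MeasurableSpace Ω]
    {μ : Measure Ω} [IsProbabilityMeasure μ] {f : Ω → α} {A : Finset α} (hA : A.Nonempty)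
    (hf : ∀ ω, f ω ∈ A) (hunif : ∀ a ∈ A, μ {ω | f ω = a} = (A.card : ENNReal)⁻¹)
    (S : Set α) : NullMeasurableSet (f ⁻¹' S) μ := by
  classical
  apply nullMeasurableSet_of_measure_add_compl_le
  have h1 : μ (f ⁻¹' S) ≤ (A.filter (· ∈ S)).card * (A.card : ENNReal)⁻¹ :=
    measure_preimage_le_card_mul (fun a ha => hunif a (Finset.mem_filter.1 ha).1)
      fun ω hω => Finset.mem_filter.2 ⟨hf ω, hω⟩
  have h2 : μ (f ⁻¹' S)ᶜ ≤ (A.filter (¬ · ∈ S)).card * (A.card : ENNReal)⁻¹ :=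
    measure_preimage_le_card_mul (fun a ha => hunif a (Finset.mem_filter.1 ha).1)
      fun ω hω => Finset.mem_filter.2 ⟨hf ω, hω⟩
  refine (add_le_add h1 h2).trans_eq ?_
  rw [← add_mul, ← Nat.cast_add, Finset.card_filter_add_card_filter_not, measure_univ]
  exact ENNReal.mul_inv_cancel (by simpa using hA.ne_empty) (by simp)

theorem mgf_indicator_one {Ω : Type*} [MeasurableSpace Ω] {μ : Measure Ω}
    [IsProbabilityMeasure μ] {s : Set Ω} (hs : NullMeasurableSet s μ) (t : ℝ) :
    mgf (s.indicator 1) μ t = 1 + μ.real s * (Real.exp t - 1) := by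
  have h : (fun ω => Real.exp (t * s.indicator (1 : Ω → ℝ) ω)) =
      fun ω => 1 + s.indicator (fun _ => Real.exp t - 1) ω := by
    funext ω
    by_cases hω : ω ∈ s <;> simp [hω]
  rw [mgf, h, integral_add (integrable_const _)
    ((integrable_const (Real.exp t - 1)).indicator₀ hs), integral_indicator₀ hs]
  simp

/-- Multiplicative Chernoff upper tail for sums of independent indicators. -/
theorem measureReal_le_sum_indicator_le_exp {Ω ι : Type*} [MeasurableSpace Ω] [Fintype ι]
    {μ : Measure Ω} [IsProbabilityMeasure μ] {A : ι → Set Ω}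
    (hA : ∀ j, NullMeasurableSet (A j) μ)
    (hindep : iIndepFun (fun j => (A j).indicator (1 : Ω → ℝ)) μ)
    {p a ε : ℝ} (hp : ∀ j, μ.real (A j) ≤ p) (ha : 0 ≤ a) (hε0 : 0 ≤ ε) (hε1 : ε ≤ 1)
    (hpa : Fintype.card ι * p ≤ a * (1 - ε)) :
    μ.real {ω | a ≤ (∑ j, (A j).indicator (1 : Ω → ℝ)) ω} ≤ Real.exp (-(a * ε ^ 2 / 10)) := by
  have hmeas : ∀ j, AEMeasurable ((A j).indicator (1 : Ω → ℝ)) μ := fun j =>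
    (aemeasurable_const (b := (1 : ℝ))).indicator₀ (hA j)
  have hint : Integrable (fun ω => Real.exp (ε / 2 * (∑ j, (A j).indicator (1 : Ω → ℝ)) ω)) μ := by
    refine Integrable.of_bound (Real.measurable_exp.comp_aemeasurable
      ((Finset.aemeasurable_sum _ fun j _ => hmeas j).const_mul _)).aestronglyMeasurable
      (Real.exp (ε / 2 * Fintype.card ι)) (.of_forall fun ω => ?_)
    rw [Real.norm_of_nonneg (Real.exp_nonneg _), Finset.sum_apply]
    gcongr
    refine (Finset.sum_le_card_nsmul Finset.univ _ 1 fun j _ => ?_).trans (by simp)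
    exact Set.indicator_le_self' (by simp) ω
  refine (measure_ge_le_exp_mul_mgf a (by positivity) hint).trans ?_
  rw [hindep.mgf_sum₀ hmeas]
  have hexp0 : 0 ≤ Real.exp (ε / 2) - 1 := by
    linarith [Real.add_one_le_exp (ε / 2)]
  have hexp : Real.exp (ε / 2) - 1 ≤ ε / 2 + (ε / 2) ^ 2 := by
    have := Real.abs_exp_sub_one_sub_id_le (x := ε / 2) (by rw [abs_le]; constructor <;> linarith)
    linarith [(abs_le.1 this).2]
  have hprod : ∏ j, mgf ((A j).indicator (1 : Ω → ℝ)) μ (ε / 2) ≤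
      Real.exp (Fintype.card ι * p * (Real.exp (ε / 2) - 1)) := by
    calc ∏ j, mgf ((A j).indicator (1 : Ω → ℝ)) μ (ε / 2)
        ≤ ∏ _j : ι, Real.exp (p * (Real.exp (ε / 2) - 1)) := by
          refine Finset.prod_le_prod (fun j _ => mgf_nonneg) fun j _ => ?_
          rw [mgf_indicator_one (hA j)]
          have := Real.add_one_le_exp (p * (Real.exp (ε / 2) - 1))
          have := mul_le_mul_of_nonneg_right (hp j) hexp0
          linarith
      _ = _ := by
          rw [Finset.prod_const, ← Real.exp_nat_mul, Finset.card_univ, mul_assoc]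
  refine (mul_le_mul_of_nonneg_left hprod (Real.exp_nonneg _)).trans ?_
  rw [← Real.exp_add]
  apply Real.exp_le_exp.2
  have h1 := mul_le_mul_of_nonneg_right hpa hexp0
  have h2 := mul_le_mul_of_nonneg_left hexp (mul_nonneg ha (sub_nonneg.2 hε1))
  have h3 : 0 ≤ a * ε ^ 2 := by positivity
  have h4 : 0 ≤ a * ε ^ 3 := by positivity
  nlinarith

/-- **Degree estimation guarantee for low-degree vertices.** Sampling `r` edges i.i.d.
uniformly from `E` and setting `d̂(v) = (m/r) |{j : v ∈ eⱼ}|`, with probability at least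
`1 - n exp(-r τ εD² / (10 m))`, simultaneously every vertex `v` with
`deg(v) ≤ τ(1-εD)` satisfies `d̂(v) ≤ τ`. -/
theorem degree_estimation_low_degree
    {V : Type*} [Fintype V] (G : SimpleGraph V) [DecidableRel G.Adj]
    (n m : ℕ) (hn : n = Fintype.card V) (hn2 : 2 ≤ n)
    (hm : m = G.edgeSet.ncard) (hm1 : 1 ≤ m)
    (τ : ℝ) (hτ : 1 ≤ τ) (εD : ℝ) (hεD0 : 0 < εD) (hεD1 : εD ≤ 1 / 2)
    {Ω : Type*} [MeasurableSpace Ω] (μ : Measure Ω) [IsProbabilityMeasure μ]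
    (r : ℕ)
    (e : Fin r → Ω → Sym2 V)
    (hindep : iIndepFun (m := fun _ => ⊤) e μ)
    (hmem : ∀ j ω, e j ω ∈ G.edgeSet)
    (hunif : ∀ j : Fin r, ∀ ε' ∈ G.edgeSet, μ {ω | e j ω = ε'} = (m : ENNReal)⁻¹)
    (dhat : Ω → V → ℝ)
    (hdhat : ∀ ω w, dhat ω w = (m / r : ℝ) * ({j : Fin r | w ∈ e j ω}.ncard : ℝ)) :
    1 - n * Real.exp (-(r * τ * εD ^ 2 / (10 * m))) ≤
      (μ {ω | ∀ w : V, (G.degree w : ℝ) ≤ τ * (1 - εD) → dhat ω w ≤ τ}).toReal := by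
  classical
  have hm' : m = G.edgeFinset.card := by
    rw [hm, ← SimpleGraph.coe_edgeFinset, Set.ncard_coe_finset]
  have hm0 : (0 : ℝ) < m := by exact_mod_cast hm1
  have hr0 : (0 : ℝ) ≤ r := Nat.cast_nonneg r
  let B : V → Fin r → Set Ω := fun w j => e j ⁻¹' {x | w ∈ x}
  have hBmeas : ∀ w j, NullMeasurableSet (B w j) μ := fun w j =>
    nullMeasurableSet_preimage_of_uniform (A := G.edgeFinset)
      (Finset.card_pos.1 (hm' ▸ hm1)) (fun ω => SimpleGraph.mem_edgeFinset.2 (hmem j ω))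
      (fun a ha => hm' ▸ hunif j a (SimpleGraph.mem_edgeFinset.1 ha)) _
  have hBprob : ∀ w j, μ.real (B w j) ≤ G.degree w / m := fun w j => by
    have h : μ (B w j) ≤ (G.incidenceFinset w).card * (m : ENNReal)⁻¹ :=
      measure_preimage_le_card_mul
        (fun a ha => hunif j a ((G.mem_incidenceFinset w a).1 ha).1)
        fun ω hω => (G.mem_incidenceFinset w _).2 ⟨hmem j ω, hω⟩
    rw [G.card_incidenceFinset_eq_degree] at h
    have hfin : (G.degree w : ENNReal) * (m : ENNReal)⁻¹ ≠ ⊤ :=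
      ENNReal.mul_ne_top (by simp) (by simpa using (Nat.one_le_iff_ne_zero.1 hm1))
    simpa [div_eq_mul_inv, measureReal_def] using ENNReal.toReal_mono hfin h
  have hBindep : ∀ w, iIndepFun (fun j => (B w j).indicator (1 : Ω → ℝ)) μ := fun w =>
    hindep.comp (mβ := fun _ => ⊤) (fun _ x => Set.indicator {x | w ∈ x} (1 : Sym2 V → ℝ) x)
      fun _ => measurable_from_top
  have hcount : ∀ w ω, (({j : Fin r | w ∈ e j ω}.ncard : ℕ) : ℝ) =
      (∑ j, (B w j).indicator (1 : Ω → ℝ)) ω := fun w ω => by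
    rw [Finset.sum_apply, Set.ncard_eq_toFinset_card', Set.toFinset_ofPred]
    simp [B, Set.indicator_apply]
  have htail : ∀ w : V, μ.real {ω | (G.degree w : ℝ) ≤ τ * (1 - εD) ∧ τ < dhat ω w} ≤
      Real.exp (-(r * τ * εD ^ 2 / (10 * m))) := fun w => by
    by_cases hw : (G.degree w : ℝ) ≤ τ * (1 - εD)
    swap
    · simp only [hw, false_and, Set.ofPred_false, measureReal_empty]
      exact Real.exp_nonneg _
    have hch := measureReal_le_sum_indicator_le_exp (hBmeas w) (hBindep w) (hBprob w)
      (a := r * τ / m) (ε := εD) (by positivity) hεD0.le (by linarith)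
      (by
        rw [Fintype.card_fin, mul_div_assoc', div_mul_eq_mul_div, mul_assoc]
        gcongr)
    rw [show r * τ / m * εD ^ 2 / 10 = r * τ * εD ^ 2 / (10 * m) by field_simp] at hch
    refine (measureReal_mono fun ω hω => ?_).trans hch
    have hlt := hω.2
    rw [hdhat, hcount] at hlt
    rcases hr0.eq_or_lt with hr | hr
    · rw [← hr, div_zero, zero_mul] at hlt
      linarith
    · change r * τ / m ≤ _
      rw [div_mul_eq_mul_div, lt_div_iff₀ hr] at hlt
      rw [div_le_iff₀ hm0]
      linarith
  set good := {ω | ∀ w : V, (G.degree w : ℝ) ≤ τ * (1 - εD) → dhat ω w ≤ τ}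
  have hbad : μ.real goodᶜ ≤ n * Real.exp (-(r * τ * εD ^ 2 / (10 * m))) := by
    have hsub : goodᶜ ⊆ ⋃ w : V, {ω | (G.degree w : ℝ) ≤ τ * (1 - εD) ∧ τ < dhat ω w} := by
      intro ω hω
      simpa [good] using hω
    calc μ.real goodᶜ ≤ _ := measureReal_mono hsub
      _ ≤ ∑ w : V, μ.real {ω | (G.degree w : ℝ) ≤ τ * (1 - εD) ∧ τ < dhat ω w} :=
          measureReal_iUnion_fintype_le _
      _ ≤ ∑ _w : V, Real.exp (-(r * τ * εD ^ 2 / (10 * m))) :=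
          Finset.sum_le_sum fun w _ => htail w
      _ = _ := by rw [Finset.sum_const, Finset.card_univ, nsmul_eq_mul, hn]
  have htotal : 1 ≤ μ.real good + μ.real goodᶜ := by
    have h := measureReal_union_le (μ := μ) good goodᶜ
    rwa [Set.union_compl_self, probReal_univ] at h
  change _ ≤ μ.real good
  linarith
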